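/- arXiv:1602.05093 — 2 statements merged into one kernel-verified Lean document; each statement's English description precedes it below -/
import Mathlib

section
/- Block-decay norm of iterated compositions (equation (2.36) of the paper): Let ν ≥ 1 and s ≥ s₀. There exists a constant C = C(s, ν) > 0 such that for every Töplitz-in-time 2×2 block operator R with |R|_s < ∞ and every integer n ≥ 1, the n-fold composition R^{∘n} := R ∘ R ∘ ⋯ ∘ R satisfies |R^{∘n}|_{s₀} ≤ C(s₀, ν)^{n−1} |R|_{s₀}^{n} and |R^{∘n}|_s ≤ n C^{n} |R|_{s₀}^{n−1} |R|_s. -/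
open scoped ENNReal NNReal BigOperators

/-- A Töplitz-in-time `2 × 2` block operator: `R ℓ j j'` is the block coupling the
space modes `±j'` to `±j` at time-Fourier index `ℓ`. -/
abbrev BlockOp (ν : ℕ) := (Fin ν → ℤ) → ℕ+ → ℕ+ → Matrix (Fin 2) (Fin 2) ℂ

/-- The weight `⟨(ℓ, m)⟩^{2s} = max(1, ‖ℓ‖_∞, |m|)^{2s}` as an extended real. -/
noncomputable def bwt (ν : ℕ) (s : ℝ) (ℓ : Fin ν → ℤ) (m : ℤ) : ℝ≥0∞ :=
  ENNReal.ofReal ((max 1 (max ‖ℓ‖ ((|m| : ℤ) : ℝ))) ^ (2 * s))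

/-- The squared Frobenius norm of a `2 × 2` complex matrix, as an extended real. -/
noncomputable def frobSq (M : Matrix (Fin 2) (Fin 2) ℂ) : ℝ≥0∞ :=
  ∑ i : Fin 2, ∑ j : Fin 2, (‖M i j‖₊ : ℝ≥0∞) ^ 2

/-- The block-decay norm
`|R|_s = sup_{j'} (∑_{ℓ, j} ⟨(ℓ, j − j')⟩^{2s} ‖R(ℓ,j,j')‖²)^{1/2}` (valued in `ℝ≥0∞`). -/
noncomputable def blockNorm {ν : ℕ} (s : ℝ) (R : BlockOp ν) : ℝ≥0∞ :=
  ⨆ j' : ℕ+, (∑' ℓ : Fin ν → ℤ, ∑' j : ℕ+,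
    bwt ν s ℓ (((j : ℕ) : ℤ) - ((j' : ℕ) : ℤ)) * frobSq (R ℓ j j')) ^ (1/2 : ℝ)

/-- Composition of Töplitz-in-time block operators:
`(R ∘ B)(ℓ, j, j') = ∑_{ℓ', k} R(ℓ − ℓ', j, k) · B(ℓ', k, j')`. -/
noncomputable def bcomp {ν : ℕ} (R B : BlockOp ν) : BlockOp ν :=
  fun ℓ j j' => ∑' q : (Fin ν → ℤ) × ℕ+, R (ℓ - q.1) j q.2 * B q.1 q.2 j'

/-- `s₀ = ⌊(ν+1)/2⌋ + 1`. -/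
def s0 (ν : ℕ) : ℕ := (ν + 1) / 2 + 1

/-- `bpow R n` is the `(n+1)`-fold composition `R ∘ ⋯ ∘ R` (`n+1` factors). -/
noncomputable def bpow {ν : ℕ} (R : BlockOp ν) : ℕ → BlockOp ν
  | 0 => R
  | n + 1 => bcomp R (bpow R n)

/-- Hölder's inequality with exponents `2, 2` for sums of extended nonnegative reals. -/
lemma ENNReal.tsum_mul_le_sqrt_mul_sqrt {ι : Type*} (f g : ι → ℝ≥0∞) :
    ∑' i, f i * g i ≤ (∑' i, f i ^ 2) ^ (1 / 2 : ℝ) * (∑' i, g i ^ 2) ^ (1 / 2 : ℝ) := by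
  rw [ENNReal.tsum_eq_iSup_sum]
  refine iSup_le fun t => ?_
  refine (ENNReal.inner_le_Lp_mul_Lq t f g Real.HolderConjugate.two_two).trans ?_
  simp only [ENNReal.rpow_two]
  gcongr <;> exact ENNReal.sum_le_tsum t

lemma ENNReal.sq_rpow_half (x : ℝ≥0∞) : (x ^ (1 / 2 : ℝ)) ^ 2 = x := by
  rw [← ENNReal.rpow_two, ← ENNReal.rpow_mul]
  norm_num

/-- Weighted Cauchy–Schwarz inequality. -/
lemma ENNReal.sq_tsum_le_tsum_mul_tsum_inv_mul_sq {ι : Type*} (c x : ι → ℝ≥0∞)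
    (h0 : ∀ i, c i ≠ 0) (hT : ∀ i, c i ≠ ⊤) :
    (∑' i, x i) ^ 2 ≤ (∑' i, c i) * ∑' i, (c i)⁻¹ * x i ^ 2 := by
  have key := ENNReal.tsum_mul_le_sqrt_mul_sqrt (fun i => c i ^ (1 / 2 : ℝ))
    (fun i => ((c i)⁻¹) ^ (1 / 2 : ℝ) * x i)
  simp only [mul_pow, ENNReal.sq_rpow_half] at key
  have hx : ∀ i, c i ^ (1 / 2 : ℝ) * (((c i)⁻¹) ^ (1 / 2 : ℝ) * x i) = x i := fun i => by
    rw [← mul_assoc, ← ENNReal.mul_rpow_of_nonneg _ _ (by norm_num),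
      ENNReal.mul_inv_cancel (h0 i) (hT i), ENNReal.one_rpow, one_mul]
  simp only [hx] at key
  calc (∑' i, x i) ^ 2
      ≤ ((∑' i, c i) ^ (1 / 2 : ℝ) * (∑' i, (c i)⁻¹ * x i ^ 2) ^ (1 / 2 : ℝ)) ^ 2 := by gcongr
    _ = _ := by rw [mul_pow, ENNReal.sq_rpow_half, ENNReal.sq_rpow_half]

lemma enorm_entry_le_frobSq (M : Matrix (Fin 2) (Fin 2) ℂ) (i j : Fin 2) :
    ‖M i j‖ₑ ≤ frobSq M ^ (1 / 2 : ℝ) := by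
  have h : ‖M i j‖ₑ ^ 2 ≤ frobSq M := by
    refine (Finset.single_le_sum (f := fun j => ‖M i j‖ₑ ^ 2) (fun _ _ => zero_le)
      (Finset.mem_univ j)).trans ?_
    exact Finset.single_le_sum (f := fun i => ∑ j, ‖M i j‖ₑ ^ 2) (fun _ _ => zero_le)
      (Finset.mem_univ i)
  calc ‖M i j‖ₑ = (‖M i j‖ₑ ^ 2) ^ (1 / 2 : ℝ) := by
        rw [← ENNReal.rpow_two, ← ENNReal.rpow_mul]; norm_num
    _ ≤ _ := by gcongr

lemma enorm_tsum_entry_le {ι : Type*} (F : ι → Matrix (Fin 2) (Fin 2) ℂ) (i j : Fin 2) :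
    ‖(∑' q, F q) i j‖ₑ ≤ ∑' q, ‖F q i j‖ₑ := by
  by_cases h : Summable F
  · have h' : Summable fun q => F q i := Pi.summable.1 h i
    have e : (∑' q, F q) i j = ∑' q, F q i j := by
      rw [← tsum_apply h']
      exact congrFun (tsum_apply h) j
    rw [e]
    exact enorm_tsum_le_tsum_enorm
  · simp [tsum_eq_zero_of_not_summable h]

lemma frobSq_tsum_mul_le {ι : Type*} (A B : ι → Matrix (Fin 2) (Fin 2) ℂ) :
    frobSq (∑' q, A q * B q) ≤
      16 * (∑' q, frobSq (A q) ^ (1 / 2 : ℝ) * frobSq (B q) ^ (1 / 2 : ℝ)) ^ 2 := by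
  set S := ∑' q, frobSq (A q) ^ (1 / 2 : ℝ) * frobSq (B q) ^ (1 / 2 : ℝ) with hS
  have entry : ∀ i j, ‖(∑' q, A q * B q) i j‖ₑ ≤ 2 * S := fun i j => by
    refine (enorm_tsum_entry_le _ i j).trans ?_
    rw [hS, ← ENNReal.tsum_mul_left]
    refine ENNReal.tsum_le_tsum fun q => ?_
    rw [Matrix.mul_apply, Fin.sum_univ_two, two_mul]
    refine (enorm_add_le _ _).trans ?_
    rw [enorm_mul, enorm_mul]
    gcongr <;> exact enorm_entry_le_frobSq _ _ _
  calc frobSq (∑' q, A q * B q) ≤ ∑ _i : Fin 2, ∑ _j : Fin 2, (2 * S) ^ 2 := by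
        refine Finset.sum_le_sum fun i _ => Finset.sum_le_sum fun j _ => ?_
        exact pow_le_pow_left₀ zero_le (entry i j) 2
    _ = 16 * S ^ 2 := by
        simp only [Fin.sum_univ_two]
        ring

lemma bwt_eq_norm (ν : ℕ) (s : ℝ) (ℓ : Fin ν → ℤ) (m : ℤ) :
    bwt ν s ℓ m = ENNReal.ofReal (max 1 ‖(ℓ, m)‖ ^ (2 * s)) := by
  rw [bwt, Prod.norm_def, Int.norm_eq_abs, Int.cast_abs]

lemma bwt_ne_zero (ν : ℕ) (s : ℝ) (ℓ : Fin ν → ℤ) (m : ℤ) : bwt ν s ℓ m ≠ 0 := by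
  rw [bwt_eq_norm]
  simp only [ne_eq, ENNReal.ofReal_eq_zero, not_le]
  positivity

lemma bwt_ne_top (ν : ℕ) (s : ℝ) (ℓ : Fin ν → ℤ) (m : ℤ) : bwt ν s ℓ m ≠ ⊤ :=
  ENNReal.ofReal_ne_top

lemma bwt_add_le (ν : ℕ) {s : ℝ} (hs : 0 ≤ s) (ℓ₁ ℓ₂ : Fin ν → ℤ) (m₁ m₂ : ℤ) :
    bwt ν s (ℓ₁ + ℓ₂) (m₁ + m₂) ≤
      ENNReal.ofReal (2 ^ (2 * s)) * (bwt ν s ℓ₁ m₁ + bwt ν s ℓ₂ m₂) := by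
  simp only [bwt_eq_norm]
  rw [← ENNReal.ofReal_add (by positivity) (by positivity), ← ENNReal.ofReal_mul (by positivity)]
  refine ENNReal.ofReal_le_ofReal ?_
  set a := max 1 ‖(ℓ₁, m₁)‖
  set b := max 1 ‖(ℓ₂, m₂)‖
  have ha : 0 < a := by positivity
  have hb : 0 < b := by positivity
  have hab : max 1 ‖(ℓ₁ + ℓ₂, m₁ + m₂)‖ ≤ 2 * max a b := by
    have h1 : 1 ≤ a := le_max_left _ _
    have h2 := norm_add_le (ℓ₁, m₁) (ℓ₂, m₂)
    have h3 : ‖(ℓ₁, m₁)‖ ≤ a := le_max_right _ _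
    have h4 : ‖(ℓ₂, m₂)‖ ≤ b := le_max_right _ _
    have h5 := le_max_left a b
    have h6 := le_max_right a b
    rw [Prod.mk_add_mk] at h2
    exact max_le (by linarith) (by linarith)
  calc max 1 ‖(ℓ₁ + ℓ₂, m₁ + m₂)‖ ^ (2 * s) ≤ (2 * max a b) ^ (2 * s) := by gcongr
    _ = 2 ^ (2 * s) * max a b ^ (2 * s) := Real.mul_rpow (by norm_num) (by positivity)
    _ ≤ 2 ^ (2 * s) * (a ^ (2 * s) + b ^ (2 * s)) := by
        gcongr
        have := Real.rpow_pos_of_pos ha (2 * s)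
        have := Real.rpow_pos_of_pos hb (2 * s)
        rcases max_choice a b with h | h <;> rw [h] <;> linarith

/-- The integer lattice `ℤ^ν × ℤ` mapped into `ℝ^ν × ℝ`. -/
noncomputable def intProdCast (ν : ℕ) : (Fin ν → ℤ) × ℤ →ₗ[ℤ] (Fin ν → ℝ) × ℝ :=
  ((Int.castAddHom ℝ).toIntLinearMap.compLeft (Fin ν)).prodMap (Int.castAddHom ℝ).toIntLinearMap

lemma norm_intProdCast (ν : ℕ) (x : (Fin ν → ℤ) × ℤ) : ‖intProdCast ν x‖ = ‖x‖ := by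
  have h : ‖(intProdCast ν x).1‖ = ‖x.1‖ := by
    simp only [Pi.norm_def]
    congr 2
  rw [Prod.norm_def, Prod.norm_def, h]
  simp [intProdCast, Int.norm_eq_abs]

lemma summable_norm_int_prod_rpow (ν : ℕ) {r : ℝ} (hr : r < -(ν + 1 : ℝ)) :
    Summable fun x : (Fin ν → ℤ) × ℤ => ‖x‖ ^ r := by
  have hinj : Function.Injective (intProdCast ν) := by
    refine (injective_iff_map_eq_zero _).2 fun x hx => ?_
    rw [← norm_eq_zero, ← norm_intProdCast, hx, norm_zero]
  let e := LinearEquiv.ofInjective (intProdCast ν) hinj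
  have hnorm : ∀ x, ‖e x‖ = ‖x‖ := norm_intProdCast ν
  have : DiscreteTopology (LinearMap.range (intProdCast ν)) := by
    refine DiscreteTopology.of_forall_le_norm one_pos fun z hz => ?_
    obtain ⟨x, rfl⟩ := e.surjective z
    have hx : x ≠ 0 := fun h => hz (by rw [h, map_zero])
    rw [hnorm, Prod.norm_def, le_max_iff]
    by_cases h2 : x.2 = 0
    · left
      have h1 : x.1 ≠ 0 := fun h => hx (Prod.ext h h2)
      obtain ⟨i, hi⟩ := Function.ne_iff.1 h1
      refine le_trans ?_ (norm_le_pi_norm x.1 i)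
      rw [Int.norm_eq_abs]
      exact_mod_cast Int.one_le_abs hi
    · right
      rw [Int.norm_eq_abs]
      exact_mod_cast Int.one_le_abs h2
  have hrank : Module.finrank ℤ (LinearMap.range (intProdCast ν)) = ν + 1 := by
    rw [← e.finrank_eq]
    simp
  have h := ZLattice.summable_norm_rpow (LinearMap.range (intProdCast ν)) r
    (by rw [hrank]; push_cast; exact hr)
  refine (e.toEquiv.summable_iff.2 h).congr fun x => ?_
  simp only [Function.comp_apply]
  exact congrArg (· ^ r) (hnorm x).symm

lemma tsum_inv_bwt_ne_top (ν : ℕ) {s : ℝ} (hs : (ν + 1 : ℝ) < 2 * s) :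
    ∑' x : (Fin ν → ℤ) × ℤ, (bwt ν s x.1 x.2)⁻¹ ≠ ⊤ := by
  have hsum : Summable fun x : (Fin ν → ℤ) × ℤ => (max 1 ‖x‖ ^ (2 * s))⁻¹ := by
    have h0 := summable_norm_int_prod_rpow ν (r := -(2 * s)) (by linarith)
    have h1 : Summable (Function.update (fun x : (Fin ν → ℤ) × ℤ => ‖x‖ ^ (-(2 * s))) 0 1) :=
      h0.update 0 1
    refine h1.of_nonneg_of_le (fun x => by positivity) fun x => ?_
    by_cases hx : x = 0
    · subst hx
      simp
    · rw [Function.update_of_ne hx, Real.rpow_neg (norm_nonneg x)]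
      have : 0 < ‖x‖ := norm_pos_iff.2 hx
      have hν : (0 : ℝ) ≤ ν := by positivity
      gcongr
      · linarith
      · exact le_max_right _ _
  convert hsum.tsum_ofReal_ne_top using 4 with x
  rw [bwt_eq_norm, ENNReal.ofReal_inv_of_pos (by positivity)]

/-- The square of the norm of the column `j'`. -/
noncomputable def colSum {ν : ℕ} (s : ℝ) (R : BlockOp ν) (j' : ℕ+) : ℝ≥0∞ :=
  ∑' p : (Fin ν → ℤ) × ℕ+, bwt ν s p.1 (((p.2 : ℕ) : ℤ) - ((j' : ℕ) : ℤ)) * frobSq (R p.1 p.2 j')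

lemma blockNorm_eq_iSup_colSum {ν : ℕ} (s : ℝ) (R : BlockOp ν) :
    blockNorm s R = ⨆ j', colSum s R j' ^ (1 / 2 : ℝ) := by
  simp only [blockNorm, colSum]
  refine iSup_congr fun j' => ?_
  rw [← ENNReal.tsum_prod]

lemma colSum_le_blockNorm_sq {ν : ℕ} (s : ℝ) (R : BlockOp ν) (j' : ℕ+) :
    colSum s R j' ≤ blockNorm s R ^ 2 := by
  rw [← ENNReal.sq_rpow_half (colSum s R j'), blockNorm_eq_iSup_colSum]
  gcongr
  exact le_iSup (fun j' => colSum s R j' ^ (1 / 2 : ℝ)) j'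

lemma colSum_shift {ν : ℕ} (s : ℝ) (R : BlockOp ν) (ℓ' : Fin ν → ℤ) (k : ℕ+) :
    ∑' p : (Fin ν → ℤ) × ℕ+, bwt ν s (p.1 - ℓ') (((p.2 : ℕ) : ℤ) - ((k : ℕ) : ℤ)) *
      frobSq (R (p.1 - ℓ') p.2 k) = colSum s R k :=
  ((Equiv.subRight ℓ').prodCongr (Equiv.refl ℕ+)).tsum_eq fun p : (Fin ν → ℤ) × ℕ+ =>
    bwt ν s p.1 (((p.2 : ℕ) : ℤ) - ((k : ℕ) : ℤ)) * frobSq (R p.1 p.2 k)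

/-- Summing over all output modes the product of a weighted column of `R` and one of `B`. -/
lemma tsum_tsum_weighted_le {ν : ℕ} (s t : ℝ) (R B : BlockOp ν) (j' : ℕ+) :
    ∑' p : (Fin ν → ℤ) × ℕ+, ∑' q : (Fin ν → ℤ) × ℕ+,
      (bwt ν s (p.1 - q.1) (((p.2 : ℕ) : ℤ) - ((q.2 : ℕ) : ℤ)) * frobSq (R (p.1 - q.1) p.2 q.2)) *
      (bwt ν t q.1 (((q.2 : ℕ) : ℤ) - ((j' : ℕ) : ℤ)) * frobSq (B q.1 q.2 j')) ≤
      (blockNorm s R * blockNorm t B) ^ 2 := by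
  rw [ENNReal.tsum_comm]
  simp only [ENNReal.tsum_mul_right, colSum_shift]
  calc _ ≤ ∑' q : (Fin ν → ℤ) × ℕ+, blockNorm s R ^ 2 *
        (bwt ν t q.1 (((q.2 : ℕ) : ℤ) - ((j' : ℕ) : ℤ)) * frobSq (B q.1 q.2 j')) := by
        gcongr
        exact colSum_le_blockNorm_sq _ _ _
    _ = blockNorm s R ^ 2 * colSum t B j' := ENNReal.tsum_mul_left
    _ ≤ _ := by
        rw [mul_pow]
        gcongr
        exact colSum_le_blockNorm_sq _ _ _

lemma bwt_mul_frobSq_bcomp_le {ν : ℕ} {s : ℝ} (hs : 0 ≤ s) (t : ℝ) (R B : BlockOp ν)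
    (ℓ : Fin ν → ℤ) (j j' : ℕ+) :
    bwt ν s ℓ (((j : ℕ) : ℤ) - ((j' : ℕ) : ℤ)) * frobSq (bcomp R B ℓ j j') ≤
      32 * ENNReal.ofReal (2 ^ (2 * s)) * (∑' x : (Fin ν → ℤ) × ℤ, (bwt ν t x.1 x.2)⁻¹) *
      ((∑' q : (Fin ν → ℤ) × ℕ+,
        (bwt ν s (ℓ - q.1) (((j : ℕ) : ℤ) - ((q.2 : ℕ) : ℤ)) * frobSq (R (ℓ - q.1) j q.2)) *
        (bwt ν t q.1 (((q.2 : ℕ) : ℤ) - ((j' : ℕ) : ℤ)) * frobSq (B q.1 q.2 j'))) +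
      ∑' q : (Fin ν → ℤ) × ℕ+,
        (bwt ν t (ℓ - q.1) (((j : ℕ) : ℤ) - ((q.2 : ℕ) : ℤ)) * frobSq (R (ℓ - q.1) j q.2)) *
        (bwt ν s q.1 (((q.2 : ℕ) : ℤ) - ((j' : ℕ) : ℤ)) * frobSq (B q.1 q.2 j'))) := by
  set Z := ∑' x : (Fin ν → ℤ) × ℤ, (bwt ν t x.1 x.2)⁻¹ with hZ
  set K := ENNReal.ofReal (2 ^ (2 * s))
  let u : ℝ → (Fin ν → ℤ) × ℕ+ → ℝ≥0∞ := fun r q =>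
    bwt ν r (ℓ - q.1) (((j : ℕ) : ℤ) - ((q.2 : ℕ) : ℤ))
  let v : ℝ → (Fin ν → ℤ) × ℕ+ → ℝ≥0∞ := fun r q =>
    bwt ν r q.1 (((q.2 : ℕ) : ℤ) - ((j' : ℕ) : ℤ))
  let a : (Fin ν → ℤ) × ℕ+ → ℝ≥0∞ := fun q => frobSq (R (ℓ - q.1) j q.2)
  let b : (Fin ν → ℤ) × ℕ+ → ℝ≥0∞ := fun q => frobSq (B q.1 q.2 j')
  let c : (Fin ν → ℤ) × ℕ+ → ℝ≥0∞ := fun q => (u t q)⁻¹ + (v t q)⁻¹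
  set W := bwt ν s ℓ (((j : ℕ) : ℤ) - ((j' : ℕ) : ℤ))
  have hc0 : ∀ q, c q ≠ 0 := fun q => by
    simp [c, u, v, bwt_ne_top]
  have hcT : ∀ q, c q ≠ ⊤ := fun q => by
    simp [c, u, v, bwt_ne_zero]
  have hcu : ∀ q, (c q)⁻¹ ≤ u t q := fun q => ENNReal.inv_le_iff_inv_le.1 le_self_add
  have hcv : ∀ q, (c q)⁻¹ ≤ v t q := fun q => ENNReal.inv_le_iff_inv_le.1 le_add_self
  have hW : ∀ q, W ≤ K * (u s q + v s q) := fun q => by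
    have := bwt_add_le ν hs (ℓ - q.1) q.1 (((j : ℕ) : ℤ) - ((q.2 : ℕ) : ℤ))
      (((q.2 : ℕ) : ℤ) - ((j' : ℕ) : ℤ))
    rwa [sub_add_cancel, sub_add_sub_cancel] at this
  have hsumc : ∑' q, c q ≤ 2 * Z := by
    rw [ENNReal.tsum_add, two_mul]
    refine add_le_add ?_ ?_
    · refine ENNReal.tsum_comp_le_tsum_of_injective
        (f := fun q : (Fin ν → ℤ) × ℕ+ => (ℓ - q.1, ((j : ℕ) : ℤ) - ((q.2 : ℕ) : ℤ))) ?_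
        (fun x => (bwt ν t x.1 x.2)⁻¹)
      rintro ⟨x, k⟩ ⟨y, l⟩ h
      simpa using h
    · refine ENNReal.tsum_comp_le_tsum_of_injective
        (f := fun q : (Fin ν → ℤ) × ℕ+ => (q.1, ((q.2 : ℕ) : ℤ) - ((j' : ℕ) : ℤ))) ?_
        (fun x => (bwt ν t x.1 x.2)⁻¹)
      rintro ⟨x, k⟩ ⟨y, l⟩ h
      simpa using h
  have hterm : ∀ q, W * ((c q)⁻¹ * (a q * b q)) ≤
      K * ((u s q * a q) * (v t q * b q) + (u t q * a q) * (v s q * b q)) := fun q =>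
    calc W * ((c q)⁻¹ * (a q * b q))
        ≤ (K * (u s q + v s q)) * ((c q)⁻¹ * (a q * b q)) := by gcongr; exact hW q
      _ = K * (u s q * (c q)⁻¹ * (a q * b q) + v s q * (c q)⁻¹ * (a q * b q)) := by ring
      _ ≤ K * (u s q * v t q * (a q * b q) + v s q * u t q * (a q * b q)) := by
          gcongr
          · exact hcv q
          · exact hcu q
      _ = _ := by ring
  have hcs := ENNReal.sq_tsum_le_tsum_mul_tsum_inv_mul_sq c
    (fun q => a q ^ (1 / 2 : ℝ) * b q ^ (1 / 2 : ℝ)) hc0 hcT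
  simp only [mul_pow, ENNReal.sq_rpow_half] at hcs
  calc W * frobSq (bcomp R B ℓ j j')
      ≤ W * (16 * (∑' q, a q ^ (1 / 2 : ℝ) * b q ^ (1 / 2 : ℝ)) ^ 2) := by
        gcongr
        exact frobSq_tsum_mul_le _ _
    _ ≤ W * (16 * ((2 * Z) * ∑' q, (c q)⁻¹ * (a q * b q))) := by
        gcongr
        exact hcs.trans (by gcongr)
    _ = 32 * Z * ∑' q, W * ((c q)⁻¹ * (a q * b q)) := by
        rw [ENNReal.tsum_mul_left]
        ring
    _ ≤ 32 * Z * ∑' q, K * ((u s q * a q) * (v t q * b q) + (u t q * a q) * (v s q * b q)) := by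
        exact mul_le_mul_right (ENNReal.tsum_le_tsum hterm) _
    _ = _ := by
        rw [ENNReal.tsum_mul_left, ENNReal.tsum_add]
        simp only [u, v, a, b]
        ring

/-- Tame estimate for the composition of two block operators. -/
lemma exists_blockNorm_bcomp_le (ν : ℕ) {s t : ℝ} (hs : 0 ≤ s) (ht : (ν + 1 : ℝ) < 2 * t) :
    ∃ D : ℝ≥0∞, D ≠ ⊤ ∧ ∀ R B : BlockOp ν, blockNorm s (bcomp R B) ≤
      D * (blockNorm s R * blockNorm t B + blockNorm t R * blockNorm s B) := by
  set M := 32 * ENNReal.ofReal (2 ^ (2 * s)) * ∑' x : (Fin ν → ℤ) × ℤ, (bwt ν t x.1 x.2)⁻¹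
  have hM : M ≠ ⊤ := ENNReal.mul_ne_top (ENNReal.mul_ne_top (by simp) ENNReal.ofReal_ne_top)
    (tsum_inv_bwt_ne_top ν ht)
  refine ⟨M ^ (1 / 2 : ℝ), ENNReal.rpow_ne_top_of_nonneg (by norm_num) hM, fun R B => ?_⟩
  rw [blockNorm_eq_iSup_colSum s (bcomp R B)]
  refine iSup_le fun j' => ?_
  set X := blockNorm s R * blockNorm t B
  set Y := blockNorm t R * blockNorm s B
  have hcol : colSum s (bcomp R B) j' ≤ M * (X + Y) ^ 2 :=
    calc colSum s (bcomp R B) j' ≤ M * (X ^ 2 + Y ^ 2) := by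
          have h := ENNReal.tsum_le_tsum fun p : (Fin ν → ℤ) × ℕ+ =>
            bwt_mul_frobSq_bcomp_le hs t R B p.1 p.2 j'
          rw [ENNReal.tsum_mul_left, ENNReal.tsum_add] at h
          exact h.trans (mul_le_mul_right (add_le_add (tsum_tsum_weighted_le s t R B j')
            (tsum_tsum_weighted_le t s R B j')) _)
      _ ≤ M * (X + Y) ^ 2 := by
          gcongr
          calc X ^ 2 + Y ^ 2 ≤ X ^ 2 + Y ^ 2 + 2 * X * Y := le_self_add
            _ = (X + Y) ^ 2 := by ring
  calc colSum s (bcomp R B) j' ^ (1 / 2 : ℝ) ≤ (M * (X + Y) ^ 2) ^ (1 / 2 : ℝ) := by gcongr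
    _ = M ^ (1 / 2 : ℝ) * (X + Y) := by
        rw [ENNReal.mul_rpow_of_nonneg _ _ (by norm_num), ← ENNReal.rpow_two (X + Y),
          ← ENNReal.rpow_mul]
        norm_num

lemma add_one_lt_two_mul_s0 (ν : ℕ) : (ν + 1 : ℝ) < 2 * ((s0 ν : ℕ) : ℝ) := by
  have h : ν + 1 < 2 * s0 ν := by
    unfold s0
    omega
  exact_mod_cast h

/-- Block-decay norm of iterated compositions (equation (2.36)): for `n ≥ 1`,
`|R^{∘n}|_{s₀} ≤ C^{n−1} |R|_{s₀}^n` and `|R^{∘n}|_s ≤ n C^n |R|_{s₀}^{n−1} |R|_s`.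
Here `bpow R (n − 1)` is the `n`-fold composition power of `R`. -/
theorem blockNorm_bpow (ν : ℕ) (hν : 1 ≤ ν) (s : ℝ) (hs : ((s0 ν : ℕ) : ℝ) ≤ s) :
    ∃ C : ℝ≥0∞, 1 ≤ C ∧ C < ⊤ ∧ ∀ R : BlockOp ν, blockNorm s R < ⊤ →
      ∀ n : ℕ, 1 ≤ n →
        blockNorm ((s0 ν : ℕ) : ℝ) (bpow R (n - 1)) ≤
          C ^ (n - 1) * blockNorm ((s0 ν : ℕ) : ℝ) R ^ n ∧
        blockNorm s (bpow R (n - 1)) ≤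
          (n : ℝ≥0∞) * C ^ n * blockNorm ((s0 ν : ℕ) : ℝ) R ^ (n - 1) * blockNorm s R := by
  have ht := add_one_lt_two_mul_s0 ν
  have hν0 : (0 : ℝ) ≤ ν := by positivity
  obtain ⟨D, hD, hDs⟩ := exists_blockNorm_bcomp_le ν (s := s) (by linarith) ht
  obtain ⟨E, hE, hEs⟩ := exists_blockNorm_bcomp_le ν (s := ((s0 ν : ℕ) : ℝ)) (by linarith) ht
  set C := 1 + D + 2 * E with hC
  have hC1 : 1 ≤ C := by rw [hC, add_assoc]; exact le_self_add
  have hDC : D ≤ C := by rw [hC]; exact le_add_self.trans le_self_add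
  have hEC : 2 * E ≤ C := by rw [hC]; exact le_add_self
  refine ⟨C, hC1, by simp [hC, ENNReal.mul_lt_top, hD.lt_top, hE.lt_top], fun R _ n hn => ?_⟩
  obtain ⟨n, rfl⟩ := Nat.exists_eq_add_of_le' hn
  rw [Nat.add_sub_cancel]
  set x := blockNorm ((s0 ν : ℕ) : ℝ) R
  set y := blockNorm s R
  clear hn
  induction n with
  | zero =>
    refine ⟨by simp [bpow, x], ?_⟩
    simpa [bpow, y] using le_mul_of_one_le_left zero_le hC1
  | succ n ih =>
    obtain ⟨ih0, ihs⟩ := ih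
    constructor
    · calc blockNorm ((s0 ν : ℕ) : ℝ) (bcomp R (bpow R n))
          ≤ E * (x * blockNorm ((s0 ν : ℕ) : ℝ) (bpow R n) +
              x * blockNorm ((s0 ν : ℕ) : ℝ) (bpow R n)) := hEs _ _
        _ = 2 * E * (x * blockNorm ((s0 ν : ℕ) : ℝ) (bpow R n)) := by ring
        _ ≤ C * (x * (C ^ n * x ^ (n + 1))) := by gcongr
        _ = _ := by ring
    · calc blockNorm s (bcomp R (bpow R n))
          ≤ D * (y * blockNorm ((s0 ν : ℕ) : ℝ) (bpow R n) + x * blockNorm s (bpow R n)) :=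
            hDs _ _
        _ ≤ C * (y * (C ^ (n + 1) * x ^ (n + 1)) +
              x * (((n + 1 : ℕ) : ℝ≥0∞) * C ^ (n + 1) * x ^ n * y)) := by
            gcongr
            refine ih0.trans ?_
            gcongr
            exact n.le_succ
        _ = _ := by
            push_cast
            ring
end

section
/- Block-decay norm of a rank-one integral operator (Lemma 2.12): Let ν ≥ 1 and s ≥ s₀. There exists a constant C = C(s, ν) > 0 such that the following holds. Let q, g : ℤ^ν × ℤ → ℂ satisfy q(ℓ, 0) = g(ℓ, 0) = 0 for all ℓ ∈ ℤ^ν, and ‖q‖_s, ‖g‖_s < ∞, where ‖q‖_s := (∑_{(ℓ,k) ∈ ℤ^ν × ℤ} ⟨(ℓ, k)⟩^{2s} |q(ℓ, k)|²)^{1/2}. Define the Töplitz-in-time 2×2 block operator R whose block R(ℓ, j, j') has entries, for k ∈ {j, −j} and k' ∈ {j', −j'}, R_k^{k'}(ℓ) := ∑_{ℓ' ∈ ℤ^ν} q(ℓ − ℓ', k) g(ℓ', −k'). Then |R|_s ≤ C (‖q‖_s ‖g‖_{s₀} + ‖q‖_{s₀} ‖g‖_s). -/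
open scoped ENNReal NNReal BigOperators

/-- The weighted `ℓ²` norm `‖q‖_s = (∑_{ℓ,k} ⟨(ℓ,k)⟩^{2s} |q(ℓ,k)|²)^{1/2}` of a
function `q : ℤ^ν × ℤ → ℂ` (valued in `ℝ≥0∞`). -/
noncomputable def fullNorm {ν : ℕ} (s : ℝ) (q : (Fin ν → ℤ) → ℤ → ℂ) : ℝ≥0∞ :=
  (∑' ℓ : Fin ν → ℤ, ∑' k : ℤ, bwt ν s ℓ k * (‖q ℓ k‖₊ : ℝ≥0∞) ^ 2) ^ (1/2 : ℝ)

/-- The sign attached to a row/column index of a `2 × 2` block: `+1` for the first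
index, `−1` for the second, pairing the modes `j` and `−j`. -/
def sgn (a : Fin 2) : ℤ := if a = 0 then 1 else -1

/-- The rank-one integral operator of Lemma 2.12: the `(k, k')`-entry of the block
`R(ℓ, j, j')`, for `k ∈ {j, −j}`, `k' ∈ {j', −j'}`, is `∑_{ℓ'} q(ℓ−ℓ', k) g(ℓ', −k')`. -/
noncomputable def rankOneOp {ν : ℕ} (q g : (Fin ν → ℤ) → ℤ → ℂ) : BlockOp ν :=
  fun ℓ j j' => Matrix.of fun a b : Fin 2 =>
    ∑' ℓ' : Fin ν → ℤ, q (ℓ - ℓ') (sgn a * ((j : ℕ) : ℤ)) * g ℓ' (-(sgn b * ((j' : ℕ) : ℤ)))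

theorem ENNReal.tsum_mul_sq_le {ι : Type*} (f g : ι → ℝ≥0∞) :
    (∑' i, f i * g i) ^ 2 ≤ (∑' i, f i ^ 2) * ∑' i, g i ^ 2 := by
  have h : ∑' i, f i * g i ≤ (∑' i, f i ^ 2) ^ (1 / 2 : ℝ) * (∑' i, g i ^ 2) ^ (1 / 2 : ℝ) := by
    refine ENNReal.summable.tsum_le_of_sum_le fun t => ?_
    refine (ENNReal.inner_le_Lp_mul_Lq t f g Real.HolderConjugate.two_two).trans ?_
    simp only [ENNReal.rpow_two]
    gcongr <;> exact ENNReal.sum_le_tsum t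
  calc _ ≤ ((∑' i, f i ^ 2) ^ (1 / 2 : ℝ) * (∑' i, g i ^ 2) ^ (1 / 2 : ℝ)) ^ 2 := by gcongr
    _ = _ := by
      rw [mul_pow]
      simp only [← ENNReal.rpow_two, ← ENNReal.rpow_mul]
      norm_num

/-- Young's convolution inequality `ℓ² * ℓ¹ ⊆ ℓ²`. -/
theorem ENNReal.tsum_conv_sq_le {G : Type*} [AddCommGroup G] (A B : G → ℝ≥0∞) :
    ∑' x, (∑' y, A (x - y) * B y) ^ 2 ≤ (∑' x, A x ^ 2) * (∑' y, B y) ^ 2 := by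
  have hsq : ∀ b : ℝ≥0∞, (b ^ (1 / 2 : ℝ)) ^ 2 = b := fun b => by
    rw [← ENNReal.rpow_two, ← ENNReal.rpow_mul]; norm_num
  have key : ∀ x, (∑' y, A (x - y) * B y) ^ 2 ≤ (∑' y, A (x - y) ^ 2 * B y) * ∑' y, B y := by
    intro x
    have h := ENNReal.tsum_mul_sq_le (fun y => A (x - y) * B y ^ (1 / 2 : ℝ))
      (fun y => B y ^ (1 / 2 : ℝ))
    simpa only [mul_pow, hsq, mul_assoc, ← sq] using h
  calc _ ≤ ∑' x, (∑' y, A (x - y) ^ 2 * B y) * ∑' y, B y := ENNReal.tsum_le_tsum key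
    _ = (∑' y, ∑' x, A (x - y) ^ 2 * B y) * ∑' y, B y := by
      rw [ENNReal.tsum_mul_right, ENNReal.tsum_comm]
    _ = _ := by
      have : ∀ y, ∑' x, A (x - y) ^ 2 = ∑' x, A x ^ 2 := fun y =>
        (Equiv.subRight y).tsum_eq (fun x => A x ^ 2)
      simp only [ENNReal.tsum_mul_right, this, ENNReal.tsum_mul_left]
      ring

theorem ENNReal.tsum_conv_sq_le_sq_mul {G : Type*} [AddCommGroup G] (A B : G → ℝ≥0∞) :
    ∑' x, (∑' y, A (x - y) * B y) ^ 2 ≤ (∑' x, A x) ^ 2 * ∑' y, B y ^ 2 := by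
  have : ∀ x, ∑' y, A (x - y) * B y = ∑' y, B (x - y) * A y := fun x => by
    rw [← (Equiv.subLeft x).tsum_eq (fun y => A (x - y) * B y)]
    simp [mul_comm]
  simp only [this]
  exact (ENNReal.tsum_conv_sq_le B A).trans_eq (mul_comm _ _)

theorem summable_max_one_norm_rpow (ν : ℕ) {r : ℝ} (hr : r < -ν) :
    Summable fun ℓ : Fin ν → ℤ => (max 1 ‖ℓ‖) ^ r := by
  let b := Pi.basisFun ℝ (Fin ν)
  let L := Submodule.span ℤ (Set.range b)
  have hfin : Module.finrank ℤ L = ν := by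
    rw [ZLattice.rank ℝ L]; simp
  have hL := ZLattice.summable_norm_rpow L r (by rwa [hfin])
  have hmem : ∀ ℓ : Fin ν → ℤ, (fun i => (ℓ i : ℝ)) ∈ L := fun ℓ => by
    refine (b.mem_span_iff_repr_mem ℤ _).2 fun i => ?_
    simp [b]
  let φ : (Fin ν → ℤ) → L := fun ℓ => ⟨fun i => (ℓ i : ℝ), hmem ℓ⟩
  have hφ : Function.Injective φ := fun x y h => by
    ext i
    have hi : (x i : ℝ) = y i := congrFun (Subtype.ext_iff.1 h) i
    exact_mod_cast hi
  have hn : ∀ ℓ, ‖φ ℓ‖ = ‖ℓ‖ := fun ℓ => by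
    have hi : ∀ n : ℤ, ‖(n : ℝ)‖₊ = ‖n‖₊ := fun n => NNReal.eq (Int.norm_cast_real n)
    simp only [φ, Submodule.coe_norm, Pi.norm_def, hi]
  have h := hL.comp_injective hφ
  refine Summable.of_norm_bounded_eventually h ?_
  refine (Set.finite_singleton (0 : Fin ν → ℤ)).subset fun ℓ hℓ => ?_
  by_contra h0
  refine hℓ ?_
  have hpos : 0 < ‖ℓ‖ := norm_pos_iff.2 h0
  simp only [Set.mem_ofPred_eq, Function.comp, hn]
  rw [Real.norm_of_nonneg (by positivity)]
  exact Real.rpow_le_rpow_of_nonpos hpos (le_max_right _ _) (by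
    have : (0 : ℝ) ≤ ν := by positivity
    linarith)

/-- The unsquared weight `⟨(ℓ, m)⟩^s`. -/
noncomputable def halfWt (ν : ℕ) (s : ℝ) (ℓ : Fin ν → ℤ) (m : ℤ) : ℝ≥0∞ :=
  ENNReal.ofReal ((max 1 (max ‖ℓ‖ ((|m| : ℤ) : ℝ))) ^ s)

theorem halfWt_sq (ν : ℕ) (s : ℝ) (ℓ : Fin ν → ℤ) (m : ℤ) :
    halfWt ν s ℓ m ^ 2 = bwt ν s ℓ m := by
  rw [halfWt, bwt, ← ENNReal.ofReal_pow (by positivity), ← Real.rpow_natCast,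
    ← Real.rpow_mul (by positivity)]
  norm_num [mul_comm]

theorem halfWt_ne_zero (ν : ℕ) (s : ℝ) (ℓ : Fin ν → ℤ) (m : ℤ) : halfWt ν s ℓ m ≠ 0 := by
  rw [halfWt, ← pos_iff_ne_zero, ENNReal.ofReal_pos]
  positivity

theorem halfWt_ne_top (ν : ℕ) (s : ℝ) (ℓ : Fin ν → ℤ) (m : ℤ) : halfWt ν s ℓ m ≠ ⊤ :=
  ENNReal.ofReal_ne_top

theorem halfWt_le_add {ν : ℕ} {s : ℝ} (hs : 0 ≤ s) (ℓ ℓ' : Fin ν → ℤ) {m k k' : ℤ}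
    (hm : |m| ≤ |k| + |k'|) :
    halfWt ν s ℓ m ≤ ENNReal.ofReal (2 ^ s) * (halfWt ν s (ℓ - ℓ') k + halfWt ν s ℓ' k') := by
  unfold halfWt
  set x := max 1 (max ‖ℓ - ℓ'‖ ((|k| : ℤ) : ℝ))
  set y := max 1 (max ‖ℓ'‖ ((|k'| : ℤ) : ℝ))
  have hx1 : 1 ≤ x := le_max_left _ _
  have hy1 : 1 ≤ y := le_max_left _ _
  have hxl : ‖ℓ - ℓ'‖ ≤ x := (le_max_left _ _).trans (le_max_right _ _)
  have hyl : ‖ℓ'‖ ≤ y := (le_max_left _ _).trans (le_max_right _ _)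
  have hxk : ((|k| : ℤ) : ℝ) ≤ x := (le_max_right _ _).trans (le_max_right _ _)
  have hyk : ((|k'| : ℤ) : ℝ) ≤ y := (le_max_right _ _).trans (le_max_right _ _)
  have hℓ : ‖ℓ‖ ≤ ‖ℓ - ℓ'‖ + ‖ℓ'‖ := by simpa using norm_add_le (ℓ - ℓ') ℓ'
  have hm' : ((|m| : ℤ) : ℝ) ≤ ((|k| : ℤ) : ℝ) + ((|k'| : ℤ) : ℝ) := by exact_mod_cast hm
  have hle : max 1 (max ‖ℓ‖ ((|m| : ℤ) : ℝ)) ≤ 2 * max x y := by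
    have h1 := le_max_left x y
    have h2 := le_max_right x y
    refine max_le ?_ (max_le ?_ ?_) <;> linarith
  rw [← ENNReal.ofReal_add (by positivity) (by positivity),
    ← ENNReal.ofReal_mul (by positivity)]
  refine ENNReal.ofReal_le_ofReal ?_
  calc _ ≤ (2 * max x y) ^ s := Real.rpow_le_rpow (by positivity) hle hs
    _ = 2 ^ s * (max x y) ^ s := Real.mul_rpow (by norm_num) (by positivity)
    _ ≤ _ := by
      gcongr
      have hxs : 0 ≤ x ^ s := by positivity
      have hys : 0 ≤ y ^ s := by positivity
      rcases le_total x y with h | h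
      · rw [max_eq_right h]; linarith
      · rw [max_eq_left h]; linarith

/-- The constant in the embedding of weighted `ℓ²` into `ℓ¹` on `ℤ^ν`. -/
noncomputable def embConst (ν : ℕ) (s : ℝ) : ℝ≥0∞ :=
  ∑' ℓ : Fin ν → ℤ, (bwt ν s ℓ 0)⁻¹

theorem embConst_lt_top (ν : ℕ) {s : ℝ} (hs : (ν : ℝ) < 2 * s) : embConst ν s < ⊤ := by
  have h := (summable_max_one_norm_rpow ν (r := -(2 * s)) (by linarith)).tsum_ofReal_lt_top
  refine lt_of_le_of_lt (le_of_eq (tsum_congr fun ℓ => ?_)) h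
  rw [bwt, ← ENNReal.ofReal_inv_of_pos (by positivity), Real.rpow_neg (by positivity)]
  simp

theorem bwt_zero_le {ν : ℕ} {s : ℝ} (hs : 0 ≤ s) (ℓ : Fin ν → ℤ) (m : ℤ) :
    bwt ν s ℓ 0 ≤ bwt ν s ℓ m := by
  unfold bwt
  have : ((|0| : ℤ) : ℝ) ≤ ((|m| : ℤ) : ℝ) := by simp
  gcongr

theorem tsum_sq_le_embConst_mul {ν : ℕ} {s : ℝ} (hs : 0 ≤ s) (f : (Fin ν → ℤ) → ℝ≥0∞) (k : ℤ) :
    (∑' ℓ, f ℓ) ^ 2 ≤ embConst ν s * ∑' ℓ, bwt ν s ℓ k * f ℓ ^ 2 := by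
  have h := ENNReal.tsum_mul_sq_le (fun ℓ => (halfWt ν s ℓ k)⁻¹) (fun ℓ => halfWt ν s ℓ k * f ℓ)
  simp only [← mul_assoc, ENNReal.inv_mul_cancel (halfWt_ne_zero ν s _ k)
    (halfWt_ne_top ν s _ k), one_mul, mul_pow, ← ENNReal.inv_pow, halfWt_sq] at h
  refine h.trans ?_
  unfold embConst
  gcongr
  exact bwt_zero_le hs _ _

/-- Tame estimate for the weighted `ℓ²` norm of a convolution in the time index. -/
theorem tsum_bwt_conv_le {ν : ℕ} {s t : ℝ} (hs : 0 ≤ s) (ht : 0 ≤ t)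
    (q g : (Fin ν → ℤ) → ℂ) {m k k' : ℤ} (hm : |m| ≤ |k| + |k'|) :
    ∑' ℓ, bwt ν s ℓ m * ‖∑' ℓ', q (ℓ - ℓ') * g ℓ'‖ₑ ^ 2 ≤
      2 * ENNReal.ofReal (2 ^ s) ^ 2 * embConst ν t *
        ((∑' ℓ, bwt ν s ℓ k * ‖q ℓ‖ₑ ^ 2) * (∑' ℓ, bwt ν t ℓ k' * ‖g ℓ‖ₑ ^ 2) +
          (∑' ℓ, bwt ν t ℓ k * ‖q ℓ‖ₑ ^ 2) * ∑' ℓ, bwt ν s ℓ k' * ‖g ℓ‖ₑ ^ 2) := by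
  set c := ENNReal.ofReal (2 ^ s)
  set T : (Fin ν → ℤ) → ℝ≥0∞ := fun ℓ => ∑' ℓ', (halfWt ν s (ℓ - ℓ') k * ‖q (ℓ - ℓ')‖ₑ) * ‖g ℓ'‖ₑ
  set U : (Fin ν → ℤ) → ℝ≥0∞ := fun ℓ => ∑' ℓ', ‖q (ℓ - ℓ')‖ₑ * (halfWt ν s ℓ' k' * ‖g ℓ'‖ₑ)
  have hpt : ∀ ℓ, halfWt ν s ℓ m * ‖∑' ℓ', q (ℓ - ℓ') * g ℓ'‖ₑ ≤ c * (T ℓ + U ℓ) := by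
    intro ℓ
    calc _ ≤ halfWt ν s ℓ m * ∑' ℓ', ‖q (ℓ - ℓ') * g ℓ'‖ₑ := by
          gcongr; exact enorm_tsum_le_tsum_enorm
      _ = ∑' ℓ', halfWt ν s ℓ m * (‖q (ℓ - ℓ')‖ₑ * ‖g ℓ'‖ₑ) := by
          simp only [enorm_mul, ENNReal.tsum_mul_left]
      _ ≤ ∑' ℓ', c * (halfWt ν s (ℓ - ℓ') k + halfWt ν s ℓ' k') *
            (‖q (ℓ - ℓ')‖ₑ * ‖g ℓ'‖ₑ) := by
          refine ENNReal.tsum_le_tsum fun ℓ' => ?_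
          gcongr
          exact halfWt_le_add hs ℓ ℓ' hm
      _ = _ := by
          simp only [T, U, ← ENNReal.tsum_add, ← ENNReal.tsum_mul_left]
          refine tsum_congr fun ℓ' => ?_
          ring
  have hsq : ∀ ℓ, bwt ν s ℓ m * ‖∑' ℓ', q (ℓ - ℓ') * g ℓ'‖ₑ ^ 2 ≤
      2 * c ^ 2 * (T ℓ ^ 2 + U ℓ ^ 2) := by
    intro ℓ
    rw [← halfWt_sq, ← mul_pow]
    calc _ ≤ (c * (T ℓ + U ℓ)) ^ 2 := pow_le_pow_left' (hpt ℓ) 2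
      _ = c ^ 2 * (T ℓ + U ℓ) ^ 2 := mul_pow _ _ _
      _ ≤ c ^ 2 * (2 * (T ℓ ^ 2 + U ℓ ^ 2)) := by
          gcongr
          have h := ENNReal.rpow_add_le_mul_rpow_add_rpow (T ℓ) (U ℓ) (p := 2) (by norm_num)
          norm_num at h
          exact h
      _ = _ := by ring
  have hT : ∑' ℓ, T ℓ ^ 2 ≤ (∑' ℓ, bwt ν s ℓ k * ‖q ℓ‖ₑ ^ 2) *
      (embConst ν t * ∑' ℓ, bwt ν t ℓ k' * ‖g ℓ‖ₑ ^ 2) := by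
    refine (ENNReal.tsum_conv_sq_le (fun ℓ => halfWt ν s ℓ k * ‖q ℓ‖ₑ) (fun ℓ => ‖g ℓ‖ₑ)).trans ?_
    simp only [mul_pow, halfWt_sq]
    gcongr
    exact tsum_sq_le_embConst_mul ht _ _
  have hU : ∑' ℓ, U ℓ ^ 2 ≤ (embConst ν t * ∑' ℓ, bwt ν t ℓ k * ‖q ℓ‖ₑ ^ 2) *
      ∑' ℓ, bwt ν s ℓ k' * ‖g ℓ‖ₑ ^ 2 := by
    refine (ENNReal.tsum_conv_sq_le_sq_mul (fun ℓ => ‖q ℓ‖ₑ) (fun ℓ => halfWt ν s ℓ k' * ‖g ℓ‖ₑ)).trans ?_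
    simp only [mul_pow, halfWt_sq]
    gcongr
    exact tsum_sq_le_embConst_mul ht _ _
  calc _ ≤ ∑' ℓ, 2 * c ^ 2 * (T ℓ ^ 2 + U ℓ ^ 2) := ENNReal.tsum_le_tsum hsq
    _ = 2 * c ^ 2 * (∑' ℓ, T ℓ ^ 2 + ∑' ℓ, U ℓ ^ 2) := by
        rw [ENNReal.tsum_mul_left, ENNReal.tsum_add]
    _ ≤ 2 * c ^ 2 * ((∑' ℓ, bwt ν s ℓ k * ‖q ℓ‖ₑ ^ 2) *
          (embConst ν t * ∑' ℓ, bwt ν t ℓ k' * ‖g ℓ‖ₑ ^ 2) +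
        (embConst ν t * ∑' ℓ, bwt ν t ℓ k * ‖q ℓ‖ₑ ^ 2) *
          ∑' ℓ, bwt ν s ℓ k' * ‖g ℓ‖ₑ ^ 2) := by gcongr
    _ = _ := by ring

theorem fullNorm_sq {ν : ℕ} (s : ℝ) (q : (Fin ν → ℤ) → ℤ → ℂ) :
    fullNorm s q ^ 2 = ∑' k : ℤ, ∑' ℓ, bwt ν s ℓ k * ‖q ℓ k‖ₑ ^ 2 := by
  rw [fullNorm, ← ENNReal.rpow_two, ← ENNReal.rpow_mul, ENNReal.tsum_comm]
  norm_num [enorm_eq_nnnorm]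

theorem tsum_bwt_le_fullNorm_sq {ν : ℕ} (s : ℝ) (q : (Fin ν → ℤ) → ℤ → ℂ) (k : ℤ) :
    ∑' ℓ, bwt ν s ℓ k * ‖q ℓ k‖ₑ ^ 2 ≤ fullNorm s q ^ 2 := by
  rw [fullNorm_sq]
  exact ENNReal.le_tsum k

theorem abs_sgn (a : Fin 2) : |sgn a| = 1 := by
  unfold sgn; split_ifs <;> simp

theorem tsum_pnat_bwt_le_fullNorm_sq {ν : ℕ} (s : ℝ) (q : (Fin ν → ℤ) → ℤ → ℂ) (a : Fin 2) :
    ∑' j : ℕ+, ∑' ℓ, bwt ν s ℓ (sgn a * ((j : ℕ) : ℤ)) * ‖q ℓ (sgn a * ((j : ℕ) : ℤ))‖ₑ ^ 2 ≤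
      fullNorm s q ^ 2 := by
  rw [fullNorm_sq]
  have ha : sgn a ≠ 0 := fun h => by simpa [h] using abs_sgn a
  have hinj : Function.Injective fun j : ℕ+ => sgn a * ((j : ℕ) : ℤ) := fun i j hij =>
    PNat.eq (by exact_mod_cast mul_left_cancel₀ ha hij)
  exact ENNReal.tsum_comp_le_tsum_of_injective hinj
    (fun k => ∑' ℓ, bwt ν s ℓ k * ‖q ℓ k‖ₑ ^ 2)

theorem tsum_bwt_entry_le {ν : ℕ} {s t : ℝ} (hs : 0 ≤ s) (ht : 0 ≤ t)
    (q g : (Fin ν → ℤ) → ℤ → ℂ) (j' : ℕ+) (a b : Fin 2) :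
    ∑' ℓ, ∑' j : ℕ+, bwt ν s ℓ (((j : ℕ) : ℤ) - ((j' : ℕ) : ℤ)) * ‖rankOneOp q g ℓ j j' a b‖ₑ ^ 2 ≤
      2 * ENNReal.ofReal (2 ^ s) ^ 2 * embConst ν t *
        (fullNorm s q ^ 2 * fullNorm t g ^ 2 + fullNorm t q ^ 2 * fullNorm s g ^ 2) := by
  rw [ENNReal.tsum_comm]
  have hm : ∀ j : ℕ+, |((j : ℕ) : ℤ) - ((j' : ℕ) : ℤ)| ≤
      |sgn a * ((j : ℕ) : ℤ)| + |-(sgn b * ((j' : ℕ) : ℤ))| := fun j => by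
    simpa [abs_mul, abs_sgn] using abs_sub ((j : ℕ) : ℤ) ((j' : ℕ) : ℤ)
  refine (ENNReal.tsum_le_tsum fun j : ℕ+ => tsum_bwt_conv_le hs ht
    (fun ℓ => q ℓ (sgn a * ((j : ℕ) : ℤ))) (fun ℓ => g ℓ (-(sgn b * ((j' : ℕ) : ℤ))))
    (hm j)).trans ?_
  rw [ENNReal.tsum_mul_left, ENNReal.tsum_add, ENNReal.tsum_mul_right, ENNReal.tsum_mul_right]
  gcongr
  · exact tsum_pnat_bwt_le_fullNorm_sq s q a
  · exact tsum_bwt_le_fullNorm_sq t g _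
  · exact tsum_pnat_bwt_le_fullNorm_sq t q a
  · exact tsum_bwt_le_fullNorm_sq s g _

/-- Block-decay norm of a rank-one integral operator (Lemma 2.12):
`|R|_s ≤ C(s, ν) (‖q‖_s ‖g‖_{s₀} + ‖q‖_{s₀} ‖g‖_s)`. -/
theorem blockNorm_rankOneOp (ν : ℕ) (hν : 1 ≤ ν) (s : ℝ) (hs : ((s0 ν : ℕ) : ℝ) ≤ s) :
    ∃ C : ℝ≥0∞, 0 < C ∧ C < ⊤ ∧
      ∀ q g : (Fin ν → ℤ) → ℤ → ℂ,
        (∀ ℓ : Fin ν → ℤ, q ℓ 0 = 0) → (∀ ℓ : Fin ν → ℤ, g ℓ 0 = 0) →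
        fullNorm s q < ⊤ → fullNorm s g < ⊤ →
        blockNorm s (rankOneOp q g) ≤
          C * (fullNorm s q * fullNorm ((s0 ν : ℕ) : ℝ) g +
               fullNorm ((s0 ν : ℕ) : ℝ) q * fullNorm s g) := by
  have hst : (0 : ℝ) ≤ ((s0 ν : ℕ) : ℝ) := by positivity
  have hs0 : 0 ≤ s := hst.trans hs
  have hdim : (ν : ℝ) < 2 * ((s0 ν : ℕ) : ℝ) := by
    have : ν < 2 * s0 ν := by unfold s0; omega
    exact_mod_cast this
  set M : ℝ≥0∞ := 2 * ENNReal.ofReal (2 ^ s) ^ 2 * embConst ν (s0 ν : ℕ)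
  have hMtop : M ≠ ⊤ := by
    have := (embConst_lt_top ν hdim).ne
    finiteness
  refine ⟨(4 * M) ^ (1 / 2 : ℝ) + 1, by positivity, ?_, fun q g _ _ _ _ => ?_⟩
  · exact ENNReal.add_lt_top.2
      ⟨ENNReal.rpow_lt_top_of_nonneg (by norm_num) (by finiteness), ENNReal.one_lt_top⟩
  set t : ℝ := ((s0 ν : ℕ) : ℝ)
  set X := fullNorm s q * fullNorm t g
  set Y := fullNorm t q * fullNorm s g
  refine iSup_le fun j' => ?_
  have hsum : ∑' ℓ : Fin ν → ℤ, ∑' j : ℕ+, bwt ν s ℓ (((j : ℕ) : ℤ) - ((j' : ℕ) : ℤ)) *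
      frobSq (rankOneOp q g ℓ j j') ≤ 4 * M * (X + Y) ^ (2 : ℝ) := by
    calc _ = ∑ a : Fin 2, ∑ b : Fin 2, ∑' ℓ : Fin ν → ℤ, ∑' j : ℕ+,
          bwt ν s ℓ (((j : ℕ) : ℤ) - ((j' : ℕ) : ℤ)) * ‖rankOneOp q g ℓ j j' a b‖ₑ ^ 2 := by
          simp only [frobSq, ← enorm_eq_nnnorm, Fin.sum_univ_two, mul_add, ENNReal.tsum_add]
      _ ≤ ∑ a : Fin 2, ∑ b : Fin 2, M * (X ^ 2 + Y ^ 2) := by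
          gcongr with a _ b _
          simpa only [X, Y, mul_pow] using tsum_bwt_entry_le hs0 hst q g j' a b
      _ = 4 * M * (X ^ 2 + Y ^ 2) := by
          simp only [Fin.sum_univ_two]; ring
      _ ≤ 4 * M * (X + Y) ^ (2 : ℝ) := by
          rw [ENNReal.rpow_two]
          gcongr
          rw [add_sq, add_right_comm]
          exact le_self_add
  calc _ ≤ (4 * M * (X + Y) ^ (2 : ℝ)) ^ (1 / 2 : ℝ) := ENNReal.rpow_le_rpow hsum (by norm_num)
    _ = (4 * M) ^ (1 / 2 : ℝ) * (X + Y) := by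
        rw [ENNReal.mul_rpow_of_nonneg _ _ (by norm_num), ← ENNReal.rpow_mul]
        norm_num
    _ ≤ _ := by gcongr; exact le_self_add
end
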